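/- If Ψ is a special Turing functional, then for each c ∈ ω and each finite binary string σ there exists ℓ ∈ ω such that π(Ψ,σ') ≤ 2^{-c}·π(Ψ,σ) for all strings σ' ⊃ σ of length ℓ. -/

import Mathlib

/-
Common framework: oracle (relative) partial computability via codes,
Turing reducibility, the jump, Cantor-space measure, Martin-Löf randomness
and genericity relative to an oracle, Turing functionals.
-/

open scoped ENNReal

namespace TypicalDegree

/-- Codes for partial functions recursive in an oracle (Kleene-style),
    following `Nat.Partrec.Code` with an extra `oracle` constructor. -/
inductive OracleCode : Type
  | zero : OracleCode
  | succ : OracleCode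
  | left : OracleCode
  | right : OracleCode
  | oracle : OracleCode
  | pair : OracleCode → OracleCode → OracleCode
  | comp : OracleCode → OracleCode → OracleCode
  | prec : OracleCode → OracleCode → OracleCode
  | rfind' : OracleCode → OracleCode

/-- Evaluation of an oracle code relative to an oracle `g : ℕ →. ℕ`. -/
def OracleCode.eval (g : ℕ →. ℕ) : OracleCode → ℕ →. ℕ
  | .zero => pure 0
  | .succ => Nat.succ
  | .left => ↑fun n : ℕ => n.unpair.1
  | .right => ↑fun n : ℕ => n.unpair.2
  | .oracle => g
  | .pair cf cg => fun n => Nat.pair <$> OracleCode.eval g cf n <*> OracleCode.eval g cg n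
  | .comp cf cg => fun n => OracleCode.eval g cg n >>= OracleCode.eval g cf
  | .prec cf cg =>
    Nat.unpaired fun a n =>
      n.rec (OracleCode.eval g cf a) fun y IH => do
        let i ← IH
        OracleCode.eval g cg (Nat.pair a (Nat.pair y i))
  | .rfind' cf =>
    Nat.unpaired fun a m =>
      (Nat.rfind fun n => (fun m => m = 0) <$> OracleCode.eval g cf (Nat.pair a (n + m))).map
        (· + m)

/-- An effective injective numbering of oracle codes. -/
def OracleCode.encodeCode : OracleCode → ℕ
  | .zero => 0
  | .succ => 1
  | .left => 2
  | .right => 3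
  | .oracle => 4
  | .pair cf cg => 4 * Nat.pair cf.encodeCode cg.encodeCode + 5
  | .comp cf cg => 4 * Nat.pair cf.encodeCode cg.encodeCode + 6
  | .prec cf cg => 4 * Nat.pair cf.encodeCode cg.encodeCode + 7
  | .rfind' cf => 4 * Nat.pair cf.encodeCode cf.encodeCode + 8

/-- The characteristic (total) oracle of an element of Cantor space. -/
def chi (X : ℕ → Bool) : ℕ →. ℕ := fun n => Part.some (cond (X n) 1 0)

/-- `f` is partial recursive relative to the oracle `g`. -/
def RedIn (f g : ℕ →. ℕ) : Prop := ∃ c : OracleCode, c.eval g = f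

/-- A total function `ℕ → ℕ` viewed as a partial function. -/
def natFun (f : ℕ → ℕ) : ℕ →. ℕ := fun n => Part.some (f n)

/-- Turing reducibility between elements of Cantor space. -/
def TRed (X Y : ℕ → Bool) : Prop := RedIn (chi X) (chi Y)

/-- Turing equivalence. -/
def TEquiv (X Y : ℕ → Bool) : Prop := TRed X Y ∧ TRed Y X

/-- `X` is computable. -/
def ComputableSeq (X : ℕ → Bool) : Prop := TRed X fun _ => false

/-- `f : ℕ → ℕ` is computable. -/
def ComputableFun (f : ℕ → ℕ) : Prop := RedIn (natFun f) (chi fun _ => false)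

/-- The Turing jump of `X`: the halting problem relative to `X`,
    under the numbering `encodeCode`. -/
noncomputable def jump (X : ℕ → Bool) : ℕ → Bool := fun n =>
  @decide (∃ c : OracleCode, c.encodeCode = n ∧ (c.eval (chi X) n).Dom) (Classical.dec _)

/-- `∅'`, the halting problem. -/
noncomputable def zeroJump : ℕ → Bool := jump fun _ => false

/-- `X` extends the finite binary string `σ` (i.e. `σ ⊂ X`). -/
def extendsStr (X : ℕ → Bool) (σ : List Bool) : Prop :=
  ∀ i : Fin σ.length, X i.1 = σ.get i

/-- `⟦V⟧`: the open set of infinite sequences extending some string in `V`. -/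
def openOf (V : Set (List Bool)) : Set (ℕ → Bool) := {X | ∃ σ ∈ V, extendsStr X σ}

/-- The (fair-coin) measure of the open set `⟦V⟧` determined by a set of strings `V`:
    the supremum over `n` of the proportion of length-`n` strings with a prefix in `V`. -/
noncomputable def stringMeasure (V : Set (List Bool)) : ℝ≥0∞ :=
  ⨆ n : ℕ, (Nat.card {f : Fin n → Bool // ∃ σ ∈ V, σ <+: List.ofFn f} : ℝ≥0∞) / 2 ^ n

/-- The fair-coin (Lebesgue) measure on Cantor space, as the outer measure obtained from
    open coverings by sets of strings; it agrees with Lebesgue measure on measurable sets. -/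
noncomputable def cantorMeasure (S : Set (ℕ → Bool)) : ℝ≥0∞ :=
  ⨅ (V : Set (List Bool)) (_ : S ⊆ openOf V), stringMeasure V

/-- `W` is computably enumerable relative to `X`. -/
def CEIn (X : ℕ → Bool) (W : Set (List Bool)) : Prop :=
  ∃ c : OracleCode, ∀ σ : List Bool, σ ∈ W ↔ (c.eval (chi X) (Encodable.encode σ)).Dom

/-- `W` is computably enumerable. -/
def CE (W : Set (List Bool)) : Prop := CEIn (fun _ => false) W

/-- The c.e. set of strings with index `d`. -/
def ceSetOf (d : OracleCode) : Set (List Bool) :=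
  {σ | (d.eval (chi fun _ => false) (Encodable.encode σ)).Dom}

/-- The sequence `V` of sets of strings is uniformly c.e. relative to `X`. -/
def UniformCEIn (X : ℕ → Bool) (V : ℕ → Set (List Bool)) : Prop :=
  ∃ c : OracleCode, ∀ (i : ℕ) (σ : List Bool),
    σ ∈ V i ↔ (c.eval (chi X) (Nat.pair i (Encodable.encode σ))).Dom

/-- A Martin-Löf test relative to `X`. -/
def MLTest (X : ℕ → Bool) (V : ℕ → Set (List Bool)) : Prop :=
  UniformCEIn X V ∧ ∀ i : ℕ, stringMeasure (V i) < (2 : ℝ≥0∞)⁻¹ ^ i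

/-- `Y` is Martin-Löf random relative to `X`. -/
def MLRandomIn (X Y : ℕ → Bool) : Prop :=
  ∀ V : ℕ → Set (List Bool), MLTest X V → ∃ i, Y ∉ openOf (V i)

/-- `Y` is 1-random. -/
def OneRandom (Y : ℕ → Bool) : Prop := MLRandomIn (fun _ => false) Y

/-- `Y` is 2-random: Martin-Löf random relative to `∅'`. -/
def TwoRandom (Y : ℕ → Bool) : Prop := MLRandomIn zeroJump Y

/-- `Y` is weakly 2-random: it avoids every null `Π⁰₂` class
    (every null intersection of a uniformly c.e. sequence of open sets). -/
def Weak2Random (Y : ℕ → Bool) : Prop :=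
  ∀ V : ℕ → Set (List Bool), UniformCEIn (fun _ => false) V →
    cantorMeasure (⋂ i, openOf (V i)) = 0 → Y ∉ ⋂ i, openOf (V i)

/-- `Y` is 1-generic relative to `X`. -/
def OneGenericIn (X Y : ℕ → Bool) : Prop :=
  ∀ W : Set (List Bool), CEIn X W →
    ∃ σ : List Bool, extendsStr Y σ ∧ (σ ∈ W ∨ ∀ τ : List Bool, σ <+: τ → τ ∉ W)

/-- `Y` is 1-generic. -/
def OneGeneric (Y : ℕ → Bool) : Prop := OneGenericIn (fun _ => false) Y

/-- `Y` is 2-generic: 1-generic relative to `∅'`. -/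
def TwoGeneric (Y : ℕ → Bool) : Prop := OneGenericIn zeroJump Y

/-- The Turing functional coded by `c` is total on oracle `X` with value `Y ∈ 2^ω`
    (i.e. `Ψ^X = Y`). -/
def FTotal (c : OracleCode) (X : ℕ → Bool) (Y : ℕ → Bool) : Prop :=
  c.eval (chi X) = chi Y

/-- `Ψ^X ⊇ σ`: the output of the functional `c` on oracle `X` extends the string `σ`. -/
def FExtends (c : OracleCode) (X : ℕ → Bool) (σ : List Bool) : Prop :=
  ∀ i : Fin σ.length, c.eval (chi X) i.1 = Part.some (cond (σ.get i) 1 0)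

/-- `π(Ψ,σ) = μ({X : Ψ^X ⊇ σ})`. -/
noncomputable def piMeasure (c : OracleCode) (σ : List Bool) : ℝ≥0∞ :=
  cantorMeasure {X | FExtends c X σ}

/-- A Turing functional is special if every infinite binary sequence
    in its range is incomputable. -/
def Special (c : OracleCode) : Prop :=
  ∀ X Y : ℕ → Bool, FTotal c X Y → ¬ ComputableSeq Y

/-- The code `c` computes the total function `T` on strings (no oracle). -/
def ComputesFun (c : OracleCode) (T : List Bool → Bool) : Prop :=
  ∀ σ : List Bool, c.eval (chi fun _ => false) (Encodable.encode σ) = Part.some (cond (T σ) 1 0)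

/-- `T` is (the characteristic function of) a tree: closed under prefixes. -/
def IsTree (T : List Bool → Bool) : Prop :=
  ∀ σ τ : List Bool, σ <+: τ → T τ = true → T σ = true

/-- The set of infinite paths through the tree `T`; `Π⁰₁` classes are the
    sets of paths through computable trees. -/
def pathsOf (T : List Bool → Bool) : Set (ℕ → Bool) :=
  {X | ∀ n : ℕ, T (List.ofFn fun i : Fin n => X i.1) = true}

/-- The computable join `X ⊕ Y`. -/
def join (X Y : ℕ → Bool) : ℕ → Bool := fun n =>
  if n % 2 = 0 then X (n / 2) else Y (n / 2)

/-- A finite string used as a (partial) oracle. -/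
def strOracle (τ : List Bool) : ℕ →. ℕ := fun n =>
  if h : n < τ.length then Part.some (cond (τ.get ⟨n, h⟩) 1 0) else Part.none

/-- `Ψ^{τ₀}` and `Ψ^{τ₁}` are incompatible: they give different outputs somewhere. -/
def SplitPair (c : OracleCode) (τ₀ τ₁ : List Bool) : Prop :=
  ∃ (n v₀ v₁ : ℕ), v₀ ∈ c.eval (strOracle τ₀) n ∧ v₁ ∈ c.eval (strOracle τ₁) n ∧ v₀ ≠ v₁

/-- `(U,V)` is a `Ψ`-splitting above `τ`. -/
def SplittingAbove (c : OracleCode) (τ : List Bool) (U V : Finset (List Bool)) : Prop :=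
  (∃ ℓ : ℕ, ∀ σ ∈ U ∪ V, σ.length = ℓ ∧ τ <+: σ) ∧
    ∀ σ₀ ∈ U, ∀ σ₁ ∈ V, SplitPair c σ₀ σ₁

/-- The output sequence `Ψ^X` of the functional `c` on oracle `X`
    (defaults to `false` when not total). -/
noncomputable def outSeq (c : OracleCode) (X : ℕ → Bool) : ℕ → Bool := fun n =>
  @dite _ (∃ Y : ℕ → Bool, FTotal c X Y) (Classical.dec _) (fun h => h.choose n) fun _ => false

/-- `Ψ^X ↾ n`, as a finite string. -/
noncomputable def outStr (c : OracleCode) (X : ℕ → Bool) (n : ℕ) : List Bool :=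
  List.ofFn fun i : Fin n => outSeq c X i.1

/-- The degree of `M` is a minimal Turing degree. -/
def MinimalDeg (M : ℕ → Bool) : Prop :=
  ¬ ComputableSeq M ∧ ∀ Z : ℕ → Bool, TRed Z M → ComputableSeq Z ∨ TRed M Z



theorem mem_eval_comp {g : ℕ →. ℕ} {cf cg : OracleCode} {n v : ℕ} :
    v ∈ (OracleCode.comp cf cg).eval g n ↔ ∃ a ∈ cg.eval g n, v ∈ cf.eval g a :=
  Part.mem_bind_iff

theorem mem_eval_rfind' {g : ℕ →. ℕ} {cf : OracleCode} {n v : ℕ} :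
    v ∈ (OracleCode.rfind' cf).eval g n ↔
      ∃ a, ((∃ d ∈ cf.eval g (Nat.pair n.unpair.1 (a + n.unpair.2)), decide (d = 0) = true) ∧
        ∀ m < a, ∃ d ∈ cf.eval g (Nat.pair n.unpair.1 (m + n.unpair.2)), decide (d = 0) = false) ∧
        a + n.unpair.2 = v := by
  refine (Part.mem_map_iff _).trans ?_
  refine exists_congr fun a => and_congr (Nat.mem_rfind.trans ?_) Iff.rfl
  refine and_congr (Part.mem_map_iff _) ?_
  exact ⟨fun h m hm => (Part.mem_map_iff _).1 (h hm), fun h m hm => (Part.mem_map_iff _).2 (h m hm)⟩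

theorem eval_mono {g g' : ℕ →. ℕ} (h : ∀ n v, v ∈ g n → v ∈ g' n) (c : OracleCode) :
    ∀ n v, v ∈ c.eval g n → v ∈ c.eval g' n := by
  induction c with
  | zero => intro n v hv; exact hv
  | succ => intro n v hv; exact hv
  | left => intro n v hv; exact hv
  | right => intro n v hv; exact hv
  | oracle => exact h
  | pair cf cg hf hg =>
    intro n v hv
    simp only [OracleCode.eval, Seq.seq, Part.mem_bind_iff, Part.map_eq_map, Part.mem_map_iff] at hv ⊢
    obtain ⟨_, ⟨a, ha, rfl⟩, b, hb, rfl⟩ := hv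
    exact ⟨_, ⟨a, hf _ _ ha, rfl⟩, b, hg _ _ hb, rfl⟩
  | comp cf cg hf hg =>
    intro n v hv
    simp only [mem_eval_comp] at hv ⊢
    obtain ⟨a, ha, hb⟩ := hv
    exact ⟨a, hg _ _ ha, hf _ _ hb⟩
  | prec cf cg hf hg =>
    intro n
    simp only [OracleCode.eval, Nat.unpaired]
    induction n.unpair.2 with
    | zero => exact hf _
    | succ y ih =>
      intro v hv
      simp only [Part.bind_eq_bind, Part.mem_bind_iff] at hv ⊢
      obtain ⟨a, ha, hb⟩ := hv
      exact ⟨a, ih _ ha, hg _ _ hb⟩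
  | rfind' cf hf =>
    intro n v hv
    simp only [mem_eval_rfind'] at hv ⊢
    obtain ⟨a, ⟨⟨b, hb, hb'⟩, h2⟩, rfl⟩ := hv
    refine ⟨a, ⟨⟨b, hf _ _ hb, hb'⟩, fun m hm => ?_⟩, rfl⟩
    obtain ⟨d, hd, hd'⟩ := h2 m hm
    exact ⟨d, hf _ _ hd, hd'⟩

theorem exists_common {P : ℕ → ℕ → Prop} (hP : ∀ i k k', k ≤ k' → P i k → P i k') (m : ℕ)
    (h : ∀ i < m, ∃ k, P i k) : ∃ k, ∀ i < m, P i k := by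
  induction m with
  | zero => exact ⟨0, fun i hi => absurd hi (Nat.not_lt_zero _)⟩
  | succ m ih =>
    obtain ⟨k, hk⟩ := ih fun i hi => h i (by omega)
    obtain ⟨k', hk'⟩ := h m (by omega)
    refine ⟨max k k', fun i hi => ?_⟩
    rcases Nat.lt_succ_iff_lt_or_eq.1 hi with hi | rfl
    · exact hP _ _ _ (le_max_left _ _) (hk i hi)
    · exact hP _ _ _ (le_max_right _ _) hk'

theorem eval_use {g : ℕ → ℕ →. ℕ} {G : ℕ →. ℕ} (hm : ∀ k k', k ≤ k' → ∀ n v, v ∈ g k n → v ∈ g k' n)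
    (hG : ∀ n v, v ∈ G n → ∃ k, v ∈ g k n) (c : OracleCode) :
    ∀ n v, v ∈ c.eval G n → ∃ k, v ∈ c.eval (g k) n := by
  induction c with
  | zero => intro n v hv; exact ⟨0, hv⟩
  | succ => intro n v hv; exact ⟨0, hv⟩
  | left => intro n v hv; exact ⟨0, hv⟩
  | right => intro n v hv; exact ⟨0, hv⟩
  | oracle => exact hG
  | pair cf cg hf hg =>
    intro n v hv
    simp only [OracleCode.eval, Seq.seq, Part.mem_bind_iff, Part.map_eq_map, Part.mem_map_iff] at hv ⊢
    obtain ⟨_, ⟨a, ha, rfl⟩, b, hb, rfl⟩ := hv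
    obtain ⟨k, hk⟩ := hf _ _ ha
    obtain ⟨k', hk'⟩ := hg _ _ hb
    exact ⟨max k k', _, ⟨a, eval_mono (hm _ _ (le_max_left _ _)) _ _ _ hk, rfl⟩, b,
      eval_mono (hm _ _ (le_max_right _ _)) _ _ _ hk', rfl⟩
  | comp cf cg hf hg =>
    intro n v hv
    simp only [mem_eval_comp] at hv ⊢
    obtain ⟨a, ha, hb⟩ := hv
    obtain ⟨k, hk⟩ := hg _ _ ha
    obtain ⟨k', hk'⟩ := hf _ _ hb
    exact ⟨max k k', a, eval_mono (hm _ _ (le_max_left _ _)) _ _ _ hk,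
      eval_mono (hm _ _ (le_max_right _ _)) _ _ _ hk'⟩
  | prec cf cg hf hg =>
    intro n v hv
    simp only [OracleCode.eval, Nat.unpaired] at hv
    suffices H : ∃ k, v ∈ (OracleCode.prec cf cg).eval (g k) (Nat.pair n.unpair.1 n.unpair.2) by
      simpa using H
    simp only [OracleCode.eval, Nat.unpaired, Nat.unpair_pair]
    generalize n.unpair.2 = y at hv ⊢
    induction y generalizing v with
    | zero => exact hf _ _ hv
    | succ y ih =>
      simp only [Part.bind_eq_bind, Part.mem_bind_iff] at hv
      obtain ⟨a, ha, hb⟩ := hv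
      obtain ⟨k, hk⟩ := ih _ ha
      obtain ⟨k', hk'⟩ := hg _ _ hb
      refine ⟨max k k', ?_⟩
      simp only [Part.bind_eq_bind, Part.mem_bind_iff]
      refine ⟨a, ?_, eval_mono (hm _ _ (le_max_right _ _)) _ _ _ hk'⟩
      have := eval_mono (hm _ _ (le_max_left k k')) (OracleCode.prec cf cg) (Nat.pair n.unpair.1 y) a
      simp only [OracleCode.eval, Nat.unpaired, Nat.unpair_pair] at this
      exact this hk
  | rfind' cf hf =>
    intro n v hv
    simp only [mem_eval_rfind'] at hv ⊢
    obtain ⟨a, ⟨⟨b, hb, hb'⟩, h2⟩, rfl⟩ := hv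
    obtain ⟨k, hk⟩ := hf _ _ hb
    obtain ⟨k', hk'⟩ := exists_common
      (P := fun m k => ∃ d ∈ cf.eval (g k) (Nat.pair n.unpair.1 (m + n.unpair.2)), decide (d = 0) = false)
      (fun i k k' hkk ⟨d, hd, hd'⟩ => ⟨d, eval_mono (hm _ _ hkk) _ _ _ hd, hd'⟩) a
      (fun i hi => by
        obtain ⟨d, hd, hd'⟩ := h2 i hi
        obtain ⟨k, hk⟩ := hf _ _ hd
        exact ⟨k, d, hk, hd'⟩)
    refine ⟨max k k', a, ⟨⟨b, eval_mono (hm _ _ (le_max_left _ _)) _ _ _ hk, hb'⟩,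
      fun m hm' => ?_⟩, rfl⟩
    obtain ⟨d, hd, hzero⟩ := hk' m hm'
    exact ⟨d, eval_mono (hm _ _ (le_max_right _ _)) _ _ _ hd, hzero⟩

/-- Plain codes as oracle codes. -/
def ofCode : Nat.Partrec.Code → OracleCode
  | .zero => .zero
  | .succ => .succ
  | .left => .left
  | .right => .right
  | .pair a b => .pair (ofCode a) (ofCode b)
  | .comp a b => .comp (ofCode a) (ofCode b)
  | .prec a b => .prec (ofCode a) (ofCode b)
  | .rfind' a => .rfind' (ofCode a)

theorem eval_ofCode (g : ℕ →. ℕ) (c : Nat.Partrec.Code) : (ofCode c).eval g = c.eval := by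
  induction c with
  | zero => rfl
  | succ => rfl
  | left => rfl
  | right => rfl
  | pair a b ha hb => simp only [ofCode, OracleCode.eval, Nat.Partrec.Code.eval, ha, hb]; rfl
  | comp a b ha hb => simp only [ofCode, OracleCode.eval, Nat.Partrec.Code.eval, ha, hb]; rfl
  | prec a b ha hb => simp only [ofCode, OracleCode.eval, Nat.Partrec.Code.eval, ha, hb]; rfl
  | rfind' a ha => simp only [ofCode, OracleCode.eval, Nat.Partrec.Code.eval, ha]; rfl

theorem computableSeq_of {Y : ℕ → Bool} (h : Computable Y) : ComputableSeq Y := by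
  have h1 : Computable (fun n => cond (Y n) 1 0) :=
    Computable.cond h (Computable.const 1) (Computable.const 0)
  have h2 : Nat.Partrec (chi Y) := Partrec.nat_iff.1 h1
  obtain ⟨c, hc⟩ := Nat.Partrec.Code.exists_code.1 h2
  exact ⟨ofCode c, by rw [eval_ofCode, hc]⟩

theorem strOracle_eq (ρ : List Bool) (n : ℕ) :
    strOracle ρ n = ((ρ[n]?).map fun b => cond b 1 0 : Option ℕ) := by
  unfold strOracle
  split_ifs with h
  · simp [h]
  · simp [h]

theorem partrec_prec {F H : List Bool × ℕ →. ℕ} (hf : Partrec F) (hg : Partrec H) :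
    Partrec (fun p : List Bool × ℕ =>
        (p.2.unpair.2.rec (F (p.1, p.2.unpair.1)) fun y IH => IH.bind fun i =>
          H (p.1, Nat.pair p.2.unpair.1 (Nat.pair y i)) : Part ℕ)) := by
  have h1 : Computable (fun p : List Bool × ℕ => p.2.unpair.1) :=
    Computable.fst.comp (Computable.unpair.comp Computable.snd)
  have h2 : Computable (fun p : List Bool × ℕ => p.2.unpair.2) :=
    Computable.snd.comp (Computable.unpair.comp Computable.snd)
  have h3 : Computable (fun q : (List Bool × ℕ) × (ℕ × ℕ) =>
      (q.1.1, Nat.pair q.1.2.unpair.1 (Nat.pair q.2.1 q.2.2))) :=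
    (Computable.fst.comp Computable.fst).pair
      (Primrec₂.natPair.to_comp.comp (h1.comp Computable.fst)
        (Primrec₂.natPair.to_comp.comp (Computable.fst.comp Computable.snd)
            (Computable.snd.comp Computable.snd)))
  have h4 : Partrec₂ (fun (p : List Bool × ℕ) (q : ℕ × ℕ) =>
      H (p.1, Nat.pair p.2.unpair.1 (Nat.pair q.1 q.2))) := hg.comp h3
  have h5 : Partrec (fun p : List Bool × ℕ => F (p.1, p.2.unpair.1)) :=
    hf.comp (Computable.fst.pair h1)
  exact Partrec.nat_rec h2 h5 h4

theorem partrec_rfind' {F : List Bool × ℕ →. ℕ} (hf : Partrec F) :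
    Partrec (fun p : List Bool × ℕ =>
      (Nat.rfind fun n => (F (p.1, Nat.pair p.2.unpair.1 (n + p.2.unpair.2))).map
          fun m => decide (m = 0)).map (· + p.2.unpair.2)) := by
  have h1 : Computable (fun p : List Bool × ℕ => p.2.unpair.1) :=
    Computable.fst.comp (Computable.unpair.comp Computable.snd)
  have h2 : Computable (fun p : List Bool × ℕ => p.2.unpair.2) :=
    Computable.snd.comp (Computable.unpair.comp Computable.snd)
  have h3 : Computable (fun q : (List Bool × ℕ) × ℕ => q.2 + q.1.2.unpair.2) :=
    Primrec.nat_add.to_comp.comp Computable.snd (h2.comp Computable.fst)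
  have h4 : Computable (fun q : (List Bool × ℕ) × ℕ =>
      (q.1.1, Nat.pair q.1.2.unpair.1 (q.2 + q.1.2.unpair.2))) :=
    (Computable.fst.comp Computable.fst).pair
      (Primrec₂.natPair.to_comp.comp (h1.comp Computable.fst) h3)
  have h5 : Computable (fun q : ((List Bool × ℕ) × ℕ) × ℕ => decide (q.2 = 0)) :=
    (Primrec.eq.decide.comp Primrec.snd (Primrec.const 0)).to_comp
  have h6 : Partrec₂ (fun (p : List Bool × ℕ) (n : ℕ) =>
        (F (p.1, Nat.pair p.2.unpair.1 (n + p.2.unpair.2))).map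
          fun m => decide (m = 0)) :=
    Partrec.map (hf.comp h4) h5.to₂
  exact Partrec.map (Partrec.rfind h6) h3.to₂

theorem eval_partrec (c : OracleCode) :
    Partrec (fun p : List Bool × ℕ => c.eval (strOracle p.1) p.2) := by
  induction c with
  | zero => exact (Computable.const 0 : Computable fun p : List Bool × ℕ => 0)
  | succ => exact (Computable.succ.comp Computable.snd : Computable fun p : List Bool × ℕ => p.2.succ)
  | left => exact (Computable.fst.comp (Computable.unpair.comp Computable.snd) :
      Computable fun p : List Bool × ℕ => p.2.unpair.1)
  | right => exact (Computable.snd.comp (Computable.unpair.comp Computable.snd) :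
      Computable fun p : List Bool × ℕ => p.2.unpair.2)
  | oracle =>
    have h1 : Computable (fun p : List Bool × ℕ => (p.1[p.2]?).map fun b => cond b 1 0) :=
      Computable.option_map Computable.list_getElem?
        (Computable.cond Computable.snd (Computable.const 1) (Computable.const 0)).to₂
    exact (Computable.ofOption h1).of_eq fun p => (strOracle_eq _ _).symm
  | pair cf cg hf hg =>
    have : Partrec (fun p : List Bool × ℕ => (cf.eval (strOracle p.1) p.2).bind fun a =>
        (cg.eval (strOracle p.1) p.2).map fun b => Nat.pair a b) :=
      hf.bind (Partrec.map (hg.comp Computable.fst)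
        (Primrec₂.natPair.to_comp.comp (Computable.snd.comp Computable.fst) Computable.snd).to₂).to₂
    refine this.of_eq fun p => ?_
    simp [OracleCode.eval, Seq.seq, Part.bind_map]
  | comp cf cg hf hg =>
    have : Partrec (fun p : List Bool × ℕ => (cg.eval (strOracle p.1) p.2).bind fun a =>
        (cf.eval (strOracle p.1) a)) :=
      hg.bind (hf.comp ((Computable.fst.comp Computable.fst).pair Computable.snd)).to₂
    exact this
  | prec cf cg hf hg => exact partrec_prec hf hg
  | rfind' cf hf =>
    refine (partrec_rfind' hf).of_eq fun p => ?_
    refine Part.ext fun v => Iff.trans ?_ mem_eval_rfind'.symm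
    refine (Part.mem_map_iff _).trans ?_
    refine exists_congr fun a => and_congr (Nat.mem_rfind.trans ?_) Iff.rfl
    refine and_congr (Part.mem_map_iff _) ?_
    exact ⟨fun h m hm => (Part.mem_map_iff _).1 (h hm), fun h m hm => (Part.mem_map_iff _).2 (h m hm)⟩

section RE
variable {α β : Type} [Primcodable α] [Primcodable β]

theorem re_iff_dom {p : α → Prop} : REPred p ↔ ∃ f : α →. ℕ, Partrec f ∧ ∀ a, p a ↔ (f a).Dom := by
  constructor
  · intro h
    refine ⟨fun a => (Part.assert (p a) fun _ => Part.some ()).map fun _ => 0,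
      Partrec.map h (Computable.const 0).to₂, fun a => ?_⟩
    simp [Part.assert]
  · rintro ⟨f, hf, h⟩
    exact (Partrec.dom_re hf).of_eq fun a => (h a).symm

theorem re_comp {p : β → Prop} (hp : REPred p) {f : α → β} (hf : Computable f) :
    REPred fun a => p (f a) := by
  obtain ⟨g, hg, h⟩ := re_iff_dom.1 hp
  exact re_iff_dom.2 ⟨fun a => g (f a), hg.comp hf, fun a => h _⟩

theorem re_and {p q : α → Prop} (hp : REPred p) (hq : REPred q) : REPred fun a => p a ∧ q a := by
  obtain ⟨f, hf, h⟩ := re_iff_dom.1 hp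
  obtain ⟨g, hg, h'⟩ := re_iff_dom.1 hq
  refine re_iff_dom.2 ⟨fun a => (f a).bind fun _ => g a, hf.bind (hg.comp Computable.fst).to₂, fun a => ?_⟩
  simp [h, h', Part.bind_dom]

theorem re_of_primrec {p : α → Prop} (hp : PrimrecPred p) : REPred p := by
  obtain ⟨_, h⟩ := hp
  exact ComputablePred.to_re ⟨inferInstance, h.to_comp⟩

theorem re_forall_lt {p : α → ℕ → Prop} (hp : REPred fun x : α × ℕ => p x.1 x.2)
    {f : α → ℕ} (hf : Computable f) : REPred fun a => ∀ i < f a, p a i := by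
  obtain ⟨g, hg, h⟩ := re_iff_dom.1 hp
  have h4 : Partrec₂ (fun (a : α) (q : ℕ × ℕ) => g (a, q.1)) :=
    hg.comp (Computable.fst.pair (Computable.fst.comp Computable.snd))
  have h5 : Partrec (fun _ : α => Part.some 0) := (Computable.const 0 : Computable fun _ : α => 0)
  refine re_iff_dom.2 ⟨_, Partrec.nat_rec hf h5 h4, fun a => ?_⟩
  induction f a with
  | zero => simp
  | succ n ih =>
    simp only [Part.bind_dom, Nat.lt_succ_iff_lt_or_eq, or_imp, forall_and, forall_eq, ih]
    constructor
    · rintro ⟨h1, h2⟩; exact ⟨h1, (h (a, n)).1 h2⟩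
    · rintro ⟨h1, h2⟩; exact ⟨h1, (h (a, n)).2 h2⟩

theorem re_exists_nat {p : α → ℕ → Prop} (hp : REPred fun x : α × ℕ => p x.1 x.2) :
    REPred fun a => ∃ n, p a n := by
  obtain ⟨g, hg, h⟩ := re_iff_dom.1 hp
  obtain ⟨c, hc⟩ := Nat.Partrec.Code.exists_code.1 (Partrec.bind_decode₂_iff.1 hg)
  have hdom : ∀ x : α × ℕ, (g x).Dom ↔ ∃ k v, v ∈ Nat.Partrec.Code.evaln k c (Encodable.encode x) := by
    intro x
    have h1 : (g x).Dom ↔ (c.eval (Encodable.encode x)).Dom := by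
      rw [hc]; simp
    rw [h1, Part.dom_iff_mem]
    simp only [Nat.Partrec.Code.evaln_complete]
    exact exists_comm
  have h3 : Computable (fun q : α × ℕ => Nat.Partrec.Code.evaln q.2.unpair.1 c
      (Encodable.encode (q.1, q.2.unpair.2))) := by
    have h1 : Computable (fun q : α × ℕ => q.2.unpair.1) :=
      Computable.fst.comp (Computable.unpair.comp Computable.snd)
    have h2 : Computable (fun q : α × ℕ => q.2.unpair.2) :=
      Computable.snd.comp (Computable.unpair.comp Computable.snd)
    exact Nat.Partrec.Code.primrec_evaln.to_comp.comp
      ((h1.pair (Computable.const c)).pair (Computable.encode.comp (Computable.fst.pair h2)))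
  refine re_iff_dom.2 ⟨_, Partrec.rfindOpt h3.to₂, fun a => ?_⟩
  rw [Nat.rfindOpt_dom]
  constructor
  · rintro ⟨n, hn⟩
    obtain ⟨k, v, hv⟩ := (hdom (a, n)).1 ((h (a, n)).1 hn)
    exact ⟨Nat.pair k n, v, by simpa using hv⟩
  · rintro ⟨m, v, hv⟩
    exact ⟨m.unpair.2, (h _).2 ((hdom _).2 ⟨_, _, hv⟩)⟩

theorem re_exists {p : α → β → Prop} [Inhabited β] (hp : REPred fun x : α × β => p x.1 x.2) :
    REPred fun a => ∃ b, p a b := by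
  have hd : Computable (fun n : ℕ => (Encodable.decode (α := β) n).getD default) :=
    Computable.option_getD Computable.decode (Computable.const _)
  have h1 : Computable (fun x : α × ℕ => (x.1, (Encodable.decode (α := β) x.2).getD default)) :=
    Computable.fst.pair (hd.comp Computable.snd)
  refine (re_exists_nat (p := fun a n => p a ((Encodable.decode (α := β) n).getD default))
    (re_comp hp h1)).of_eq fun a => ?_
  constructor
  · rintro ⟨n, hn⟩; exact ⟨_, hn⟩
  · rintro ⟨b, hb⟩; exact ⟨Encodable.encode b, by simpa using hb⟩

theorem re_mem {f : α →. ℕ} (hf : Partrec f) {v : α → ℕ} (hv : Computable v) :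
    REPred fun a => v a ∈ f a := by
  have h1 : REPred fun x : α × ℕ => v x.1 = x.2 := by
    have : REPred fun x : ℕ × ℕ => x.1 = x.2 := re_of_primrec Primrec.eq
    exact re_comp this ((hv.comp Computable.fst).pair Computable.snd)
  obtain ⟨g, hg, h⟩ := re_iff_dom.1 h1
  refine re_iff_dom.2 ⟨fun a => (f a).bind fun w => g (a, w), hf.bind hg.to₂, fun a => ?_⟩
  rw [Part.dom_iff_mem]
  simp only [Part.mem_bind_iff]
  constructor
  · intro hm
    obtain ⟨y, hy⟩ := Part.dom_iff_mem.1 ((h (a, v a)).1 rfl)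
    exact ⟨y, _, hm, hy⟩
  · rintro ⟨y, w, hw, hy⟩
    have : v a = w := (h (a, w)).2 (Part.dom_iff_mem.2 ⟨y, hy⟩)
    rw [this]; exact hw

end RE

/-- Strings that force `Ψ` to output `τ`. -/
def strV (c : OracleCode) (τ : List Bool) : Set (List Bool) :=
  {ρ | ∀ i < τ.length, (cond (τ.getD i false) 1 0) ∈ c.eval (strOracle ρ) i}

/-- A finite certificate that `Ψ` outputs `τ` with measure more than `b / a`. -/
def Cert (c : OracleCode) (a b : ℕ) (τ : List Bool) (L : List (List Bool)) (s : ℕ) : Prop :=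
  (∀ j < L.length, (L.getD j []).length = s) ∧
  (∀ j < L.length, ∀ i < j, L.getD j [] ≠ L.getD i []) ∧
  b * 2 ^ s < L.length * a ∧
  ∀ j < L.length, ∀ i < τ.length, (cond (τ.getD i false) 1 0) ∈ c.eval (strOracle (L.getD j [])) i

theorem primrec_two_pow : Primrec (fun s : ℕ => 2 ^ s) := by
  have : Primrec (fun s : ℕ => Nat.rec (motive := fun _ => ℕ) 1 (fun _ IH => 2 * IH) s) :=
    Primrec.nat_rec₁ 1 (Primrec.nat_mul.comp (Primrec.const 2) Primrec.snd).to₂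
  refine this.of_eq fun s => ?_
  induction s with
  | zero => rfl
  | succ n ih => rw [pow_succ, mul_comm, ← ih]

theorem re_cert (c : OracleCode) (a b : ℕ) :
    REPred fun x : (List Bool × List (List Bool)) × ℕ => Cert c a b x.1.1 x.1.2 x.2 := by
  have hL : Primrec (fun x : (List Bool × List (List Bool)) × ℕ => x.1.2) :=
    Primrec.snd.comp Primrec.fst
  have hτ : Primrec (fun x : (List Bool × List (List Bool)) × ℕ => x.1.1) :=
    Primrec.fst.comp Primrec.fst
  have hlen : Primrec (fun x : (List Bool × List (List Bool)) × ℕ => x.1.2.length) :=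
    Primrec.list_length.comp hL
  have hget : Primrec (fun x : ((List Bool × List (List Bool)) × ℕ) × ℕ => x.1.1.2.getD x.2 []) :=
    (Primrec.list_getD []).comp (hL.comp Primrec.fst) Primrec.snd
  refine re_and ?_ (re_and ?_ (re_and ?_ ?_))
  · refine re_forall_lt (p := fun (x : (List Bool × List (List Bool)) × ℕ) j =>
      (x.1.2.getD j []).length = x.2) ?_ hlen.to_comp
    exact re_of_primrec (Primrec.eq.comp (Primrec.list_length.comp hget)
      (Primrec.snd.comp Primrec.fst))
  · refine re_forall_lt (p := fun (x : (List Bool × List (List Bool)) × ℕ) j =>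
      ∀ i < j, x.1.2.getD j [] ≠ x.1.2.getD i []) ?_ hlen.to_comp
    refine re_forall_lt (p := fun (x : ((List Bool × List (List Bool)) × ℕ) × ℕ) i =>
      x.1.1.2.getD x.2 [] ≠ x.1.1.2.getD i []) ?_ Computable.snd
    refine re_of_primrec (PrimrecPred.not (Primrec.eq.comp (hget.comp Primrec.fst) ?_))
    exact hget.comp ((Primrec.fst.comp Primrec.fst).pair Primrec.snd)
  · refine re_of_primrec (Primrec.nat_lt.comp ?_ ?_)
    · exact Primrec.nat_mul.comp (Primrec.const b) (primrec_two_pow.comp Primrec.snd)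
    · exact Primrec.nat_mul.comp hlen (Primrec.const a)
  · refine re_forall_lt (p := fun (x : (List Bool × List (List Bool)) × ℕ) j =>
      ∀ i < x.1.1.length, (cond (x.1.1.getD i false) 1 0) ∈
        c.eval (strOracle (x.1.2.getD j [])) i) ?_ hlen.to_comp
    refine re_forall_lt (p := fun (x : ((List Bool × List (List Bool)) × ℕ) × ℕ) i =>
      (cond (x.1.1.1.getD i false) 1 0) ∈ c.eval (strOracle (x.1.1.2.getD x.2 [])) i) ?_
      (Primrec.list_length.comp (hτ.comp Primrec.fst)).to_comp
    have h1 : Computable (fun x : (((List Bool × List (List Bool)) × ℕ) × ℕ) × ℕ =>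
        (x.1.1.1.2.getD x.1.2 [], x.2)) := ((hget.comp Primrec.fst).pair Primrec.snd).to_comp
    have h2 : Computable (fun x : (((List Bool × List (List Bool)) × ℕ) × ℕ) × ℕ =>
        (cond (x.1.1.1.1.getD x.2 false) 1 0)) :=
      Computable.cond ((Primrec.list_getD false).comp
        (hτ.comp (Primrec.fst.comp Primrec.fst)) Primrec.snd).to_comp
        (Computable.const 1) (Computable.const 0)
    exact re_mem ((eval_partrec c).comp h1) h2

theorem computable_of_cert (c : OracleCode) (a b : ℕ) (Y0 : List Bool) (Y : ℕ → Bool)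
    (h1 : ∀ τ L s, Cert c a b τ L s → (∀ i < Y0.length, τ[i]? = Y0[i]?) →
      ∀ k v, τ[k]? = some v → Y k = v)
    (h2 : ∀ k, ∃ τ L s, Cert c a b τ L s ∧ (∀ i < Y0.length, τ[i]? = Y0[i]?) ∧ τ[k]? = some (Y k)) :
    Computable Y := by
  have key : ∀ v : Bool, REPred fun k => Y k = v := by
    intro v
    have hre : REPred fun k : ℕ => ∃ x : (List Bool × List (List Bool)) × ℕ,
        Cert c a b x.1.1 x.1.2 x.2 ∧ (∀ i < Y0.length, x.1.1[i]? = Y0[i]?) ∧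
          x.1.1[k]? = some v := by
      refine re_exists (re_and ?_ (re_and ?_ ?_))
      · exact re_comp (re_cert c a b) Computable.snd
      · refine re_forall_lt
          (p := fun (y : ℕ × ((List Bool × List (List Bool)) × ℕ)) i => y.2.1.1[i]? = Y0[i]?)
          ?_ (Computable.const _)
        refine re_of_primrec (Primrec.eq.comp ?_ ?_)
        · exact Primrec.list_getElem?.comp (Primrec.fst.comp (Primrec.fst.comp
            (Primrec.snd.comp Primrec.fst))) Primrec.snd
        · exact Primrec.list_getElem?.comp (Primrec.const Y0) Primrec.snd
      · refine re_of_primrec (Primrec.eq.comp ?_ (Primrec.const _))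
        exact Primrec.list_getElem?.comp (Primrec.fst.comp (Primrec.fst.comp Primrec.snd)) Primrec.fst
    refine hre.of_eq fun k => ⟨?_, ?_⟩
    · rintro ⟨⟨⟨τ, L⟩, s⟩, hc, hp, hk⟩
      exact h1 τ L s hc hp k v hk
    · rintro rfl
      obtain ⟨τ, L, s, h⟩ := h2 k
      exact ⟨((τ, L), s), h⟩
  have : ComputablePred fun k => Y k = true :=
    ComputablePred.computable_iff_re_compl_re'.2 ⟨key true, (key false).of_eq fun k => by simp⟩
  obtain ⟨_, h⟩ := this
  refine h.of_eq fun k => ?_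
  simp

open MeasureTheory

/-- The first `n` bits of `X`. -/
def pre (X : ℕ → Bool) (n : ℕ) : List Bool := List.ofFn fun i : Fin n => X i.1

theorem pre_length (X : ℕ → Bool) (n : ℕ) : (pre X n).length = n := by simp [pre]

theorem pre_get (X : ℕ → Bool) (n i : ℕ) : (pre X n)[i]? = if i < n then some (X i) else none := by
  simp [pre, List.getElem?_ofFn]

theorem prefix_pre_iff (X : ℕ → Bool) (σ : List Bool) (n : ℕ) :
    σ <+: pre X n ↔ σ.length ≤ n ∧ extendsStr X σ := by
  rw [List.prefix_iff_getElem?]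
  constructor
  · intro h
    have hlen : σ.length ≤ n := by
      by_contra hlt
      have := h n (by omega)
      rw [pre_get] at this
      simp at this
    refine ⟨hlen, fun i => ?_⟩
    have := h i.1 i.2
    rw [pre_get, if_pos (by omega)] at this
    simpa using this
  · rintro ⟨hlen, h⟩ i hi
    rw [pre_get, if_pos (by omega)]
    simpa using h ⟨i, hi⟩

theorem fextends_iff (c : OracleCode) (X : ℕ → Bool) (τ : List Bool) :
    FExtends c X τ ↔ ∀ i v, τ[i]? = some v → (cond v 1 0) ∈ c.eval (chi X) i := by
  constructor
  · intro h i v hi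
    obtain ⟨hlt, rfl⟩ := List.getElem?_eq_some_iff.1 hi
    exact Part.eq_some_iff.1 (h ⟨i, hlt⟩)
  · intro h i
    exact Part.eq_some_iff.2 (h i.1 _ (by simp))

theorem mem_strV_iff (c : OracleCode) (ρ τ : List Bool) :
    ρ ∈ strV c τ ↔ ∀ i v, τ[i]? = some v → (cond v 1 0) ∈ c.eval (strOracle ρ) i := by
  constructor
  · intro h i v hi
    obtain ⟨hlt, rfl⟩ := List.getElem?_eq_some_iff.1 hi
    have := h i hlt
    simpa [List.getD, hlt] using this
  · intro h i hi
    exact h i _ (by simp [List.getD, hi])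

theorem strOracle_mono {ρ ρ' : List Bool} (h : ρ <+: ρ') (n v : ℕ) (hv : v ∈ strOracle ρ n) :
    v ∈ strOracle ρ' n := by
  rw [strOracle_eq] at hv ⊢
  simp only [Part.mem_coe, Option.mem_def, Option.map_eq_some_iff] at hv ⊢
  obtain ⟨b, hb, rfl⟩ := hv
  refine ⟨b, ?_, rfl⟩
  obtain ⟨hlt, rfl⟩ := List.getElem?_eq_some_iff.1 hb
  exact List.prefix_iff_getElem?.1 h n hlt

theorem strV_mono {c : OracleCode} {ρ ρ' τ : List Bool} (h : ρ <+: ρ') (hρ : ρ ∈ strV c τ) :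
    ρ' ∈ strV c τ := fun i hi => eval_mono (strOracle_mono h) c _ _ (hρ i hi)

theorem strOracle_chi {ρ : List Bool} {X : ℕ → Bool} (h : extendsStr X ρ) (n v : ℕ)
    (hv : v ∈ strOracle ρ n) : v ∈ chi X n := by
  rw [strOracle_eq] at hv
  simp only [Part.mem_coe, Option.mem_def, Option.map_eq_some_iff] at hv
  obtain ⟨b, hb, rfl⟩ := hv
  obtain ⟨hlt, rfl⟩ := List.getElem?_eq_some_iff.1 hb
  have := h ⟨n, hlt⟩
  simp only [List.get_eq_getElem] at this
  simp [chi, this]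

theorem pre_mono (X : ℕ → Bool) {k k' : ℕ} (h : k ≤ k') : pre X k <+: pre X k' := by
  rw [prefix_pre_iff, pre_length]
  refine ⟨h, fun i => ?_⟩
  have hi : i.1 < k := by simpa [pre_length] using i.2
  have := pre_get X k i.1
  rw [if_pos hi, List.getElem?_eq_getElem i.2] at this
  exact (Option.some.inj this).symm

theorem extends_pre (X : ℕ → Bool) (k : ℕ) : extendsStr X (pre X k) := by
  exact ((prefix_pre_iff X (pre X k) k).1 (List.prefix_refl _)).2

theorem fextends_iff_open (c : OracleCode) (τ : List Bool) :
    {X | FExtends c X τ} = openOf (strV c τ) := by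
  ext X
  change FExtends c X τ ↔ ∃ σ ∈ strV c τ, extendsStr X σ
  constructor
  · intro h
    rw [fextends_iff] at h
    have huse := eval_use (g := fun k => strOracle (pre X k)) (G := chi X)
      (fun k k' hk => strOracle_mono (pre_mono X hk))
      (fun n v hv => ⟨n + 1, by
        rw [strOracle_eq, pre_get, if_pos (by omega)]
        simpa [chi, eq_comm] using hv⟩) c
    obtain ⟨k, hk⟩ := exists_common
      (P := fun i k => (cond (τ.getD i false) 1 0) ∈ c.eval (strOracle (pre X k)) i)
      (fun i k k' hkk h => eval_mono (strOracle_mono (pre_mono X hkk)) _ _ _ h) τ.length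
      (fun i hi => huse _ _ (h i _ (by simp [List.getD, hi])))
    exact ⟨pre X k, hk, extends_pre X k⟩
  · rintro ⟨ρ, hρ, hX⟩
    rw [fextends_iff]
    rw [mem_strV_iff] at hρ
    exact fun i v hi => eval_mono (strOracle_chi hX) _ _ _ (hρ i v hi)

/-- Fair coin. -/
noncomputable def coin : Measure Bool := (PMF.uniformOfFintype Bool).toMeasure

instance : IsProbabilityMeasure coin := by unfold coin; infer_instance

theorem coin_singleton (b : Bool) : coin {b} = 2⁻¹ := by
  simp [coin]

/-- Lebesgue measure on Cantor space. -/
noncomputable def leb : Measure (ℕ → Bool) := Measure.infinitePi fun _ => coin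

instance : IsProbabilityMeasure leb := by unfold leb; infer_instance

theorem leb_cyl {n : ℕ} (f : Fin n → Bool) :
    leb ((fun (X : ℕ → Bool) (i : Fin n) => X i.1) ⁻¹' {f}) = 2⁻¹ ^ n := by
  have h : (fun (X : ℕ → Bool) (i : Fin n) => X i.1) ⁻¹' {f} =
      Set.pi (Finset.range n : Set ℕ) (fun i => {if h : i < n then f ⟨i, h⟩ else false}) := by
    ext X
    simp only [Set.mem_preimage, Set.mem_singleton_iff, Set.mem_pi, Finset.coe_range, Set.mem_Iio]
    constructor
    · rintro rfl i hi
      simp [hi]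
    · intro h
      funext i
      simpa using h i.1 i.2
  rw [h, leb, Measure.infinitePi_pi _ (fun i _ => MeasurableSet.singleton _)]
  simp [coin_singleton]

theorem measurable_restr (n : ℕ) : Measurable (fun (X : ℕ → Bool) (i : Fin n) => X i.1) := by
  fun_prop

theorem leb_preimage {n : ℕ} (P : (Fin n → Bool) → Prop) :
    leb ((fun (X : ℕ → Bool) (i : Fin n) => X i.1) ⁻¹' {f | P f}) =
      (Nat.card {f // P f} : ℝ≥0∞) / 2 ^ n := by
  classical
  have h := sum_measure_preimage_singleton (μ := leb) (Finset.univ.filter P)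
    (f := fun (X : ℕ → Bool) (i : Fin n) => X i.1)
    (fun y _ => measurable_restr n (MeasurableSet.singleton y))
  have h2 : ((Finset.univ.filter P : Finset (Fin n → Bool)) : Set (Fin n → Bool)) = {f | P f} := by
    ext f; simp
  rw [h2] at h
  rw [← h]
  simp only [leb_cyl, Finset.sum_const, nsmul_eq_mul]
  rw [Nat.card_eq_fintype_card, Fintype.card_subtype, div_eq_mul_inv, ENNReal.inv_pow]

theorem openOf_eq (V : Set (List Bool)) : openOf V =
    ⋃ n, (fun (X : ℕ → Bool) (i : Fin n) => X i.1) ⁻¹' {f | ∃ σ ∈ V, σ <+: List.ofFn f} := by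
  ext X
  simp only [Set.mem_iUnion]
  change (∃ σ ∈ V, extendsStr X σ) ↔ ∃ n, ∃ σ ∈ V, σ <+: pre X n
  simp only [prefix_pre_iff]
  constructor
  · rintro ⟨σ, h, h'⟩; exact ⟨_, σ, h, le_rfl, h'⟩
  · rintro ⟨_, σ, h, _, h'⟩; exact ⟨σ, h, h'⟩

theorem leb_openOf (V : Set (List Bool)) : leb (openOf V) = stringMeasure V := by
  rw [openOf_eq, Monotone.measure_iUnion]
  · simp only [leb_preimage]; rfl
  · intro n m hnm X hX
    obtain ⟨σ, h, h'⟩ := hX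
    exact ⟨σ, h, List.IsPrefix.trans h' (pre_mono X hnm)⟩

theorem measurable_openOf (V : Set (List Bool)) : MeasurableSet (openOf V) := by
  rw [openOf_eq]
  exact MeasurableSet.iUnion fun n => measurable_restr n (Set.toFinite _).measurableSet

theorem cantorMeasure_openOf (V : Set (List Bool)) : cantorMeasure (openOf V) = leb (openOf V) := by
  apply le_antisymm
  · rw [leb_openOf]
    exact iInf₂_le (f := fun (W : Set (List Bool)) (_ : openOf V ⊆ openOf W) => stringMeasure W)
      V subset_rfl
  · refine le_iInf₂ fun W hW => ?_
    rw [← leb_openOf]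
    exact measure_mono hW

theorem piMeasure_eq (c : OracleCode) (τ : List Bool) :
    piMeasure c τ = leb {X | FExtends c X τ} := by
  unfold piMeasure
  rw [fextends_iff_open, cantorMeasure_openOf]

theorem measurable_fextends (c : OracleCode) (τ : List Bool) :
    MeasurableSet {X | FExtends c X τ} := by
  rw [fextends_iff_open]; exact measurable_openOf _

theorem fextends_mono {c : OracleCode} {X : ℕ → Bool} {σ τ : List Bool} (h : σ <+: τ)
    (hτ : FExtends c X τ) : FExtends c X σ := by
  rw [fextends_iff] at hτ ⊢
  intro i v hi
  obtain ⟨hlt, rfl⟩ := List.getElem?_eq_some_iff.1 hi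
  exact hτ i _ (List.prefix_iff_getElem?.1 h i hlt)

theorem piMeasure_mono (c : OracleCode) {σ τ : List Bool} (h : σ <+: τ) :
    piMeasure c τ ≤ piMeasure c σ := by
  rw [piMeasure_eq, piMeasure_eq]
  exact measure_mono fun X hX => fextends_mono h hX

theorem cert_sound {c : OracleCode} {a b : ℕ} {τ : List Bool} {L : List (List Bool)} {s : ℕ}
    (h : Cert c a b τ L s) : (b : ℝ≥0∞) < a * piMeasure c τ := by
  obtain ⟨h1, h2, h3, h4⟩ := h
  have hcard : L.length ≤ Nat.card {f : Fin s → Bool // ∃ σ ∈ strV c τ, σ <+: List.ofFn f} := by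
    rw [← Nat.card_fin L.length]
    have hl : ∀ j : Fin L.length, L.getD j.1 [] =
        List.ofFn (fun i : Fin s => (L.getD j.1 []).getD i.1 false) := by
      intro j
      apply List.ext_getElem
      · simp only [List.length_ofFn]; exact h1 j.1 j.2
      · intro i hi hi'
        simp only [List.getElem_ofFn]
        rw [List.getD_eq_getElem _ _ hi]
    refine Nat.card_le_card_of_injective
      (fun j => ⟨fun i : Fin s => (L.getD j.1 []).getD i.1 false, L.getD j.1 [], h4 j.1 j.2,
        by rw [← hl]⟩) ?_
    intro j j' hjj
    simp only [Subtype.mk.injEq] at hjj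
    have : L.getD j.1 [] = L.getD j'.1 [] := by rw [hl j, hl j', hjj]
    rcases lt_trichotomy j.1 j'.1 with hlt | heq | hlt
    · exact absurd this.symm (h2 _ j'.2 _ hlt)
    · exact Fin.ext heq
    · exact absurd this (h2 _ j.2 _ hlt)
  rw [piMeasure_eq, fextends_iff_open, leb_openOf]
  have hle : (Nat.card {f : Fin s → Bool // ∃ σ ∈ strV c τ, σ <+: List.ofFn f} : ℝ≥0∞) / 2 ^ s ≤
      stringMeasure (strV c τ) := le_iSup (fun n : ℕ =>
        (Nat.card {f : Fin n → Bool // ∃ σ ∈ strV c τ, σ <+: List.ofFn f} : ℝ≥0∞) / 2 ^ n) s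
  refine lt_of_lt_of_le ?_ (mul_le_mul_right hle _)
  rw [← mul_div_assoc, ENNReal.lt_div_iff_mul_lt (by simp) (by simp)]
  have : b * 2 ^ s < a * Nat.card {f : Fin s → Bool // ∃ σ ∈ strV c τ, σ <+: List.ofFn f} :=
    lt_of_lt_of_le h3 (by rw [mul_comm]; exact Nat.mul_le_mul_left _ hcard)
  exact_mod_cast this

theorem cert_complete {c : OracleCode} {a b : ℕ} {τ : List Bool}
    (h : (b : ℝ≥0∞) < a * piMeasure c τ) : ∃ L s, Cert c a b τ L s := by
  classical
  rw [piMeasure_eq, fextends_iff_open, leb_openOf, stringMeasure, ENNReal.mul_iSup] at h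
  obtain ⟨s, hs⟩ := lt_iSup_iff.1 h
  rw [← mul_div_assoc, ENNReal.lt_div_iff_mul_lt (by simp) (by simp)] at hs
  have hs' : b * 2 ^ s < a * Nat.card {f : Fin s → Bool // ∃ σ ∈ strV c τ, σ <+: List.ofFn f} := by
    exact_mod_cast hs
  rw [Nat.card_eq_fintype_card, Fintype.card_subtype] at hs'
  set F : Finset (Fin s → Bool) := Finset.univ.filter fun f => ∃ σ ∈ strV c τ, σ <+: List.ofFn f
  have hlen : (F.toList.map List.ofFn).length = F.card := by simp
  have hmem : ∀ j < (F.toList.map List.ofFn).length, (F.toList.map List.ofFn).getD j [] ∈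
      F.toList.map List.ofFn := by
    intro j hj
    rw [List.getD_eq_getElem _ _ hj]
    exact List.getElem_mem _
  have hnd : (F.toList.map List.ofFn).Nodup := by
    refine List.Nodup.map List.ofFn_injective F.nodup_toList
  refine ⟨F.toList.map List.ofFn, s, ?_, ?_, ?_, ?_⟩
  · intro j hj
    obtain ⟨f, _, hf⟩ := List.mem_map.1 (hmem j hj)
    rw [← hf]; simp
  · intro j hj i hi heq
    rw [List.getD_eq_getElem _ _ hj, List.getD_eq_getElem _ _ (hi.trans hj)] at heq
    have := (hnd.getElem_inj_iff).1 heq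
    omega
  · rw [hlen, mul_comm F.card]; exact hs'
  · intro j hj
    obtain ⟨f, hf, hf'⟩ := List.mem_map.1 (hmem j hj)
    rw [← hf']
    simp only [F, Finset.mem_toList, Finset.mem_filter, Finset.mem_univ, true_and] at hf
    obtain ⟨σ, hσ, hp⟩ := hf
    exact strV_mono hp hσ

theorem exists_ab {m : ℝ≥0∞} (h0 : m ≠ 0) (h1 : m ≠ ∞) :
    ∃ a b : ℕ, (b : ℝ≥0∞) < a * m ∧ a * m < 2 * b := by
  lift m to NNReal using h1
  have hm : (0 : ℝ) < m := by
    have : m ≠ 0 := by simpa using h0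
    exact_mod_cast pos_iff_ne_zero.2 this
  obtain ⟨a, ha⟩ := exists_nat_gt (2 / (m : ℝ))
  rw [div_lt_iff₀ hm] at ha
  have hc : 0 < ⌈(a : ℝ) * m⌉₊ := Nat.ceil_pos.2 (by linarith)
  obtain ⟨b, hb⟩ := Nat.exists_eq_succ_of_ne_zero hc.ne'
  have e1 : (b : ℝ) < a * m := Nat.lt_ceil.1 (by omega)
  have e2 : (a : ℝ) * m ≤ b + 1 := by
    have := Nat.le_ceil ((a : ℝ) * m)
    rw [hb] at this
    exact_mod_cast this
  refine ⟨a, b, ?_, ?_⟩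
  · have : (b : NNReal) < a * m := by exact_mod_cast e1
    exact_mod_cast this
  · have : (a : NNReal) * m < 2 * b := by
      have : (a : ℝ) * m < 2 * b := by linarith
      exact_mod_cast this
    exact_mod_cast this

theorem computable_of_atom (c : OracleCode) (Y : ℕ → Bool)
    (h : (⨅ n, piMeasure c (pre Y n)) ≠ 0) : Computable Y := by
  have htop : (⨅ n, piMeasure c (pre Y n)) ≠ ∞ := by
    refine ne_top_of_le_ne_top ?_ (iInf_le _ 0)
    rw [piMeasure_eq]; exact measure_ne_top _ _
  obtain ⟨a, b, h1, h2⟩ := exists_ab h htop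
  have ha : (a : ℝ≥0∞) ≠ 0 := by
    rintro ha
    simp [ha] at h1
  have hb : ∀ n, (b : ℝ≥0∞) < a * piMeasure c (pre Y n) := fun n =>
    lt_of_lt_of_le h1 (mul_le_mul_right (iInf_le _ n) _)
  obtain ⟨n0, hn0⟩ : ∃ n0, a * piMeasure c (pre Y n0) < 2 * b := by
    have h3 : (⨅ n, piMeasure c (pre Y n)) < 2 * b / a := by
      rwa [ENNReal.lt_div_iff_mul_lt (Or.inl ha) (Or.inl (by simp)), mul_comm]
    obtain ⟨n0, hn0⟩ := iInf_lt_iff.1 h3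
    refine ⟨n0, ?_⟩
    rwa [ENNReal.lt_div_iff_mul_lt (Or.inl ha) (Or.inl (by simp)), mul_comm] at hn0
  refine computable_of_cert c a b (pre Y n0) Y ?_ ?_
  · intro τ L s hcert hpre k v hk
    by_contra hne
    have hp : pre Y n0 <+: τ := by
      rw [List.prefix_iff_getElem?]
      intro i hi
      rw [hpre i hi]; simp
    have hc := cert_sound hcert
    have hY := hb (max n0 (k + 1))
    have hdis : Disjoint {X | FExtends c X τ} {X | FExtends c X (pre Y (max n0 (k + 1)))} := by
      rw [Set.disjoint_left]
      intro X hX hX'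
      have e1 := (fextends_iff _ _ _).1 hX k v hk
      have e2 := (fextends_iff _ _ _).1 hX' k (Y k) (by rw [pre_get, if_pos (by omega)])
      have := Part.mem_unique e1 e2
      cases v <;> cases hYk : Y k <;> simp_all
    have hsum : piMeasure c τ + piMeasure c (pre Y (max n0 (k + 1))) ≤ piMeasure c (pre Y n0) := by
      rw [piMeasure_eq, piMeasure_eq, piMeasure_eq,
        ← measure_union hdis (measurable_fextends _ _)]
      refine measure_mono ?_
      rintro X (hX | hX)
      · exact fextends_mono hp hX
      · exact fextends_mono (pre_mono Y (le_max_left _ _)) hX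
    have : (2 * b : ℝ≥0∞) < 2 * b := by
      calc (2 * b : ℝ≥0∞) = b + b := two_mul _
        _ < a * piMeasure c τ + a * piMeasure c (pre Y (max n0 (k + 1))) := ENNReal.add_lt_add hc hY
        _ = a * (piMeasure c τ + piMeasure c (pre Y (max n0 (k + 1)))) := (mul_add _ _ _).symm
        _ ≤ a * piMeasure c (pre Y n0) := mul_le_mul_right hsum _
        _ < 2 * b := hn0
    exact lt_irrefl _ this
  · intro k
    obtain ⟨L, s, hL⟩ := cert_complete (hb (max n0 (k + 1)))
    refine ⟨_, L, s, hL, ?_, ?_⟩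
    · intro i hi
      rw [pre_length] at hi
      rw [pre_get, pre_get, if_pos hi, if_pos (by omega)]
    · rw [pre_get, if_pos (by omega)]

theorem decay (c : OracleCode) (hc : Special c) {ε : ℝ≥0∞} (hε : ε ≠ 0) :
    ∃ ℓ, ∀ τ : List Bool, ℓ ≤ τ.length → piMeasure c τ ≤ ε := by
  by_contra! hcon
  have hne : (⋂ n, {Y : ℕ → Bool | ε ≤ piMeasure c (pre Y n)}).Nonempty := by
    have hcl : ∀ n, IsClosed {Y : ℕ → Bool | ε ≤ piMeasure c (pre Y n)} := by
      intro n
      have hcont : Continuous (fun (X : ℕ → Bool) (i : Fin n) => X i.1) := by fun_prop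
      exact IsClosed.preimage hcont (isClosed_discrete {f | ε ≤ piMeasure c (List.ofFn f)})
    refine IsCompact.nonempty_iInter_of_sequence_nonempty_isCompact_isClosed _ ?_ ?_
      (hcl 0).isCompact hcl
    · intro n Y hY
      exact le_trans hY (piMeasure_mono c (pre_mono Y (Nat.le_succ n)))
    · intro n
      obtain ⟨τ, hτ, hlt⟩ := hcon n
      refine ⟨fun i => τ.getD i false, le_trans hlt.le (piMeasure_mono c ?_)⟩
      rw [List.prefix_iff_getElem?]
      intro i hi
      have hi' : i < n := by rwa [pre_length] at hi
      simp [pre, List.getD, show i < τ.length by omega]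
  obtain ⟨Y, hY⟩ := hne
  have hY' : ε ≤ ⨅ n, piMeasure c (pre Y n) := le_iInf fun n => Set.mem_iInter.1 hY n
  have hpos : (⨅ n, piMeasure c (pre Y n)) ≠ 0 := fun h0 => hε (le_zero_iff.1 (h0 ▸ hY'))
  have hcomp := computable_of_atom c Y hpos
  have hmeas : leb (⋂ n, {X | FExtends c X (pre Y n)}) ≠ 0 := by
    rw [Antitone.measure_iInter]
    · simpa only [piMeasure_eq] using hpos
    · intro n m hnm X hX
      exact fextends_mono (pre_mono Y hnm) hX
    · exact fun n => (measurable_fextends _ _).nullMeasurableSet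
    · exact ⟨0, measure_ne_top _ _⟩
  obtain ⟨X, hX⟩ := nonempty_of_measure_ne_zero hmeas
  refine hc X Y ?_ (computableSeq_of hcomp)
  funext i
  have hXi : FExtends c X (pre Y (i + 1)) := Set.mem_iInter.1 hX (i + 1)
  exact Part.eq_some_iff.2 ((fextends_iff _ _ _).1 hXi i (Y i)
    (by rw [pre_get, if_pos (by omega)]))

/-- If `Ψ` is a special Turing functional then for each `c ∈ ω` and
each string `σ` there exists `ℓ` such that `π(Ψ,σ') ≤ 2⁻ᶜ · π(Ψ,σ)` for all
strings `σ' ⊃ σ` of length `ℓ`. -/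
theorem special_functional_measure_decay (Ψ : OracleCode) (hΨ : Special Ψ)
    (c : ℕ) (σ : List Bool) :
    ∃ ℓ : ℕ, ∀ σ' : List Bool, σ <+: σ' → σ'.length = ℓ →
      piMeasure Ψ σ' ≤ (2 : ℝ≥0∞)⁻¹ ^ c * piMeasure Ψ σ := by
  by_cases h0 : piMeasure Ψ σ = 0
  · refine ⟨σ.length, fun σ' h _ => ?_⟩
    have := piMeasure_mono Ψ h
    rw [h0] at this ⊢
    simpa using this
  · have hε : (2 : ℝ≥0∞)⁻¹ ^ c * piMeasure Ψ σ ≠ 0 := by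
      refine mul_ne_zero (pow_ne_zero _ (by simp)) h0
    obtain ⟨ℓ, hℓ⟩ := decay Ψ hΨ hε
    -- `ℓ` may be taken at least `σ.length`, so that the statement is not vacuous
    exact ⟨max ℓ σ.length, fun σ' _ hl => hℓ σ' (by omega)⟩

end TypicalDegree
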